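/- Let f ∈ C_c^∞(ℝ²) be supported in B₁(z₁) ∪ B₁(z₂) with ∫_{ℝ²} f = 0 but ∫_{B₁(z₁)} f = m ≠ 0, where |z₁ - z₂| ≥ 4. If u is a C² function on ℝ² with Δu = f and ∫_{ℝ²}|∇u|² < ∞, then ∫_{ℝ²} |∇u|² ≥ C m² log|z₁ - z₂| - C' for constants C, C' > 0 independent of z₁, z₂. -/

import Mathlib

/- STATEMENT 2: Dirichlet energy growth for Poisson's equation on ℝ² with source
supported on two far-separated unit balls carrying opposite nonzero masses. -/

open MeasureTheory Metric

noncomputable section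

/-- The Euclidean Laplacian on `EuclideanSpace ℝ (Fin m)`. -/
noncomputable def lap {m : ℕ} (f : EuclideanSpace ℝ (Fin m) → ℝ)
    (x : EuclideanSpace ℝ (Fin m)) : ℝ :=
  ∑ i : Fin m, fderiv ℝ (fun y => fderiv ℝ f y (EuclideanSpace.single i 1)) x
    (EuclideanSpace.single i 1)

theorem exists_norm_deriv_smoothTransition_le :
    ∃ K > (0 : ℝ), ∀ t, |deriv Real.smoothTransition t| ≤ K := by
  have hc : Continuous (deriv Real.smoothTransition) :=
    (Real.smoothTransition.contDiff (n := 1)).continuous_deriv le_rfl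
  obtain ⟨K, hK⟩ := (isCompact_Icc (a := (0 : ℝ)) (b := 1)).exists_bound_of_continuousOn
    hc.continuousOn
  refine ⟨max K 1, by positivity, fun t => ?_⟩
  rcases lt_or_ge t 0 with h0 | h0
  · have : Real.smoothTransition =ᶠ[nhds t] fun _ => 0 := by
      filter_upwards [Iio_mem_nhds h0] with s hs
      exact Real.smoothTransition.zero_of_nonpos (le_of_lt hs)
    rw [this.deriv_eq]
    simp
  rcases lt_or_ge 1 t with h1 | h1
  · have : Real.smoothTransition =ᶠ[nhds t] fun _ => 1 := by
      filter_upwards [Ioi_mem_nhds h1] with s hs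
      exact Real.smoothTransition.one_of_one_le (le_of_lt hs)
    rw [this.deriv_eq]
    simp
  · exact (hK t ⟨h0, h1⟩).trans (le_max_left _ _)

/-- The logarithmic cutoff centred at `z`: equal to `1` within distance `1` of `z` and to `0`
beyond distance `R`. -/
def logCutoff {E : Type*} [NormedAddCommGroup E] (z : E) (R : ℝ) (x : E) : ℝ :=
  Real.smoothTransition (1 - Real.log (‖x - z‖ ^ 2) / (2 * Real.log R))

section LogCutoff

variable {E : Type*} [NormedAddCommGroup E] {z x : E} {R : ℝ}

theorem logCutoff_eq_one (hR : 1 < R) (hx : ‖x - z‖ ≤ 1) : logCutoff z R x = 1 := by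
  have hL := Real.log_pos hR
  apply Real.smoothTransition.one_of_one_le
  have : Real.log (‖x - z‖ ^ 2) ≤ 0 :=
    Real.log_nonpos (by positivity) (pow_le_one₀ (norm_nonneg _) hx)
  have := div_nonpos_of_nonpos_of_nonneg this (by positivity : 0 ≤ 2 * Real.log R)
  linarith

theorem logCutoff_eq_zero (hR : 1 < R) (hx : R ≤ ‖x - z‖) : logCutoff z R x = 0 := by
  have hL := Real.log_pos hR
  apply Real.smoothTransition.zero_of_nonpos
  rw [sub_nonpos, le_div_iff₀ (by positivity), Real.log_pow]
  have := Real.log_le_log (by linarith) hx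
  push_cast
  linarith

theorem hasCompactSupport_logCutoff [ProperSpace E] (hR : 1 < R) :
    HasCompactSupport (logCutoff z R) := by
  refine HasCompactSupport.intro (isCompact_closedBall z R) fun x hx => ?_
  rw [mem_closedBall, dist_eq_norm, not_le] at hx
  exact logCutoff_eq_zero hR hx.le

variable [InnerProductSpace ℝ E]

theorem contDiff_logCutoff (hR : 1 < R) : ContDiff ℝ 1 (logCutoff z R) := by
  rw [contDiff_iff_contDiffAt]
  intro x
  by_cases hx : x = z
  · subst hx
    have : logCutoff x R =ᶠ[nhds x] fun _ => 1 := by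
      filter_upwards [ball_mem_nhds x one_pos] with y hy
      rw [mem_ball, dist_eq_norm] at hy
      exact logCutoff_eq_one hR hy.le
    exact contDiffAt_const.congr_of_eventuallyEq this
  · have hne : ‖x - z‖ ^ 2 ≠ 0 := by
      simpa [sub_eq_zero] using hx
    have h1 : ContDiffAt ℝ 1 (fun y => ‖y - z‖ ^ 2) x :=
      (contDiff_id.sub contDiff_const).norm_sq ℝ |>.contDiffAt
    exact Real.smoothTransition.contDiffAt.comp x
      (contDiffAt_const.sub ((h1.log hne).div_const _))

theorem norm_fderiv_logCutoff_sq_le {K : ℝ}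
    (hK : ∀ t, |deriv Real.smoothTransition t| ≤ K) (hR : 1 < R) (x : E) :
    ‖fderiv ℝ (logCutoff z R) x‖ ^ 2 ≤
      (Set.Icc 1 R).indicator (fun r => (K / Real.log R) ^ 2 * (r ^ 2)⁻¹) ‖x - z‖ := by
  have hL := Real.log_pos hR
  by_cases hx : ‖x - z‖ ∈ Set.Icc 1 R
  · rw [Set.indicator_of_mem hx]
    have hpos : 0 < ‖x - z‖ := by linarith [hx.1]
    have h1 : HasFDerivAt (fun y => ‖y - z‖ ^ 2) (2 • innerSL ℝ (x - z)) x := by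
      simpa [Function.comp_def] using
        (hasStrictFDerivAt_norm_sq (x - z)).hasFDerivAt.comp x ((hasFDerivAt_id x).sub_const z)
    have h2 := ((h1.log (by positivity)).mul_const (2 * Real.log R)⁻¹).const_sub 1
    have h3 := (Real.smoothTransition.contDiff (n := 1)).differentiable (by simp)
      (1 - Real.log (‖x - z‖ ^ 2) * (2 * Real.log R)⁻¹) |>.hasDerivAt.comp_hasFDerivAt x h2
    have h4 := h3.congr_of_eventuallyEq (f₁ := logCutoff z R)
      (Filter.Eventually.of_forall fun y => by
        simp only [logCutoff, div_eq_mul_inv, Function.comp_apply])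
    rw [h4.fderiv, ← inv_pow, ← mul_pow]
    gcongr
    rw [norm_smul, norm_neg, norm_smul, norm_smul,
      Real.norm_of_nonneg (by positivity : 0 ≤ (2 * Real.log R)⁻¹),
      Real.norm_of_nonneg (by positivity : 0 ≤ ‖x - z‖⁻¹ ^ 2), two_nsmul, ← two_smul ℝ (innerSL ℝ (x - z)), norm_smul, innerSL_apply_norm, Real.norm_two]
    calc _ ≤ K * ((2 * Real.log R)⁻¹ * (‖x - z‖⁻¹ ^ 2 * (2 * ‖x - z‖))) := by
          gcongr
          exact hK _
      _ = _ := by field_simp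
  · rw [Set.indicator_of_notMem hx]
    have : fderiv ℝ (logCutoff z R) x = 0 := by
      have hcont : Continuous fun y : E => ‖y - z‖ := by fun_prop
      rcases lt_or_ge ‖x - z‖ 1 with h | h
      · have : logCutoff z R =ᶠ[nhds x] fun _ => 1 := by
          filter_upwards [hcont.continuousAt.eventually_lt continuousAt_const h] with y hy
          exact logCutoff_eq_one hR hy.le
        rw [this.fderiv_eq]
        simp
      · have h' : R < ‖x - z‖ := by
          by_contra hcon
          exact hx ⟨h, not_lt.1 hcon⟩
        have : logCutoff z R =ᶠ[nhds x] fun _ => 0 := by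
          filter_upwards [continuousAt_const.eventually_lt hcont.continuousAt h'] with y hy
          exact logCutoff_eq_zero hR hy.le
        rw [this.fderiv_eq]
        simp
    simp [this]

end LogCutoff

theorem integrable_indicator_annulus_norm_sq_inv {R : ℝ} (c : ℝ) (hR : 1 < R) :
    Integrable (fun x : EuclideanSpace ℝ (Fin 2) =>
        (Set.Icc 1 R).indicator (fun r => c * (r ^ 2)⁻¹) ‖x‖) ∧
      ∫ x : EuclideanSpace ℝ (Fin 2), (Set.Icc 1 R).indicator (fun r => c * (r ^ 2)⁻¹) ‖x‖ =
        2 * volume.real (ball (0 : EuclideanSpace ℝ (Fin 2)) 1) * (c * Real.log R) := by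
  have heq : (fun y : ℝ => y ^ (Module.finrank ℝ (EuclideanSpace ℝ (Fin 2)) - 1) •
      (Set.Icc 1 R).indicator (fun r => c * (r ^ 2)⁻¹) y) =
      (Set.Icc 1 R).indicator fun y => c * y⁻¹ := by
    ext y
    by_cases hy : y ∈ Set.Icc 1 R
    · have : y ≠ 0 := by linarith [hy.1]
      simp only [Set.indicator_of_mem hy, finrank_euclideanSpace_fin, smul_eq_mul,
        Nat.add_one_sub_one, pow_one]
      field_simp
    · simp [Set.indicator_of_notMem hy]
  have hsub : Set.Icc 1 R ⊆ Set.Ioi 0 := fun y hy => lt_of_lt_of_le one_pos hy.1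
  have hcont : ContinuousOn (fun y : ℝ => c * y⁻¹) (Set.Icc 1 R) :=
    continuousOn_const.mul (continuousOn_inv₀.mono fun y hy => (hsub hy).ne')
  constructor
  · rw [integrable_fun_norm_addHaar volume
      (f := (Set.Icc 1 R).indicator fun r => c * (r ^ 2)⁻¹), heq]
    exact ((integrable_indicator_iff measurableSet_Icc).2
      hcont.integrableOn_Icc).integrableOn
  · rw [integral_fun_norm_addHaar volume
      ((Set.Icc 1 R).indicator fun r => c * (r ^ 2)⁻¹), heq,
      setIntegral_indicator measurableSet_Icc, Set.inter_eq_right.2 hsub,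
      integral_Icc_eq_integral_Ioc, ← intervalIntegral.integral_of_le hR.le,
      intervalIntegral.integral_const_mul, integral_inv_of_pos one_pos (by linarith)]
    simp
    ring

theorem abs_sum_apply_single_mul_le {n : ℕ} (L M : EuclideanSpace ℝ (Fin n) →L[ℝ] ℝ) :
    |∑ i, L (EuclideanSpace.single i 1) * M (EuclideanSpace.single i 1)| ≤ ‖L‖ * ‖M‖ := by
  set v : EuclideanSpace ℝ (Fin n) :=
    ∑ i, M (EuclideanSpace.single i 1) • EuclideanSpace.single i 1 with hv
  have hLv : ∑ i, L (EuclideanSpace.single i 1) * M (EuclideanSpace.single i 1) = L v := by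
    simp [hv, map_sum, mul_comm]
  have hcoord : ∀ i, v i = M (EuclideanSpace.single i 1) := fun i => by
    simp [hv, Finset.sum_apply, Pi.single_apply]
  have hMv : ‖v‖ ^ 2 = M v := by
    rw [EuclideanSpace.real_norm_sq_eq]
    conv_rhs => rw [hv]
    simp only [hcoord, map_sum, map_smul, smul_eq_mul, sq]
  have hvM : ‖v‖ ≤ ‖M‖ := by
    rcases (norm_nonneg v).eq_or_lt with h | h
    · rw [← h]
      positivity
    · have := (le_abs_self _).trans (M.le_opNorm v)
      rw [← hMv] at this
      nlinarith
  rw [hLv]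
  exact (L.le_opNorm v).trans (by gcongr)

/-- Green's identity against a compactly supported `C¹` test function. -/
theorem integral_lap_mul_eq_neg {n : ℕ} {u φ : EuclideanSpace ℝ (Fin n) → ℝ}
    (hu : ContDiff ℝ 2 u) (hφ : ContDiff ℝ 1 φ) (hc : HasCompactSupport φ) :
    ∫ x, lap u x * φ x =
      -∫ x, ∑ i, fderiv ℝ u x (EuclideanSpace.single i 1) *
        fderiv ℝ φ x (EuclideanSpace.single i 1) := by
  have hd : ∀ i : Fin n, ContDiff ℝ 1 fun y => fderiv ℝ u y (EuclideanSpace.single i 1) :=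
    fun i => (hu.fderiv_right (m := 1) (by norm_num)).clm_apply contDiff_const
  have hdd : ∀ i : Fin n, Continuous fun x =>
      fderiv ℝ (fun y => fderiv ℝ u y (EuclideanSpace.single i 1)) x
        (EuclideanSpace.single i 1) :=
    fun i => ((hd i).continuous_fderiv (by simp)).clm_apply continuous_const
  have hdφ : ∀ i : Fin n, Continuous fun x => fderiv ℝ φ x (EuclideanSpace.single i 1) :=
    fun i => (hφ.continuous_fderiv (by simp)).clm_apply continuous_const
  have h1 : ∀ i : Fin n, Integrable fun x =>
      fderiv ℝ (fun y => fderiv ℝ u y (EuclideanSpace.single i 1)) x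
        (EuclideanSpace.single i 1) * φ x :=
    fun i => ((hdd i).mul hφ.continuous).integrable_of_hasCompactSupport hc.mul_left
  have h2 : ∀ i : Fin n, Integrable fun x => fderiv ℝ u x (EuclideanSpace.single i 1) *
      fderiv ℝ φ x (EuclideanSpace.single i 1) :=
    fun i => ((hd i).continuous.mul (hdφ i)).integrable_of_hasCompactSupport
      (hc.fderiv_apply (𝕜 := ℝ) _).mul_left
  have h3 : ∀ i : Fin n, Integrable fun x =>
      fderiv ℝ u x (EuclideanSpace.single i 1) * φ x :=
    fun i => ((hd i).continuous.mul hφ.continuous).integrable_of_hasCompactSupport hc.mul_left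
  simp only [lap, Finset.sum_mul]
  rw [integral_finsetSum _ fun i _ => h1 i, integral_finsetSum _ fun i _ => h2 i,
    ← Finset.sum_neg_distrib]
  refine Finset.sum_congr rfl fun i _ => ?_
  rw [integral_mul_fderiv_eq_neg_fderiv_mul_of_integrable (h1 i) (h2 i) (h3 i)
    (fun x _ => (hd i).differentiable (by simp) x)
    (fun x _ => hφ.differentiable (by simp) x), neg_neg]

/-- The capacity bound: testing `Δu` against `φ` controls the Dirichlet energy from below. -/
theorem sq_integral_lap_mul_le {n : ℕ} {u φ : EuclideanSpace ℝ (Fin n) → ℝ}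
    (hu : ContDiff ℝ 2 u) (hφ : ContDiff ℝ 1 φ) (hc : HasCompactSupport φ)
    (hE : Integrable fun x => ‖fderiv ℝ u x‖ ^ 2) {A : ℝ} (hA : 0 < A)
    (hφA : ∫ x, ‖fderiv ℝ φ x‖ ^ 2 ≤ A) :
    (∫ x, lap u x * φ x) ^ 2 ≤ A * ∫ x, ‖fderiv ℝ u x‖ ^ 2 := by
  obtain ⟨I, hI⟩ : ∃ I, I = ∫ x, lap u x * φ x := ⟨_, rfl⟩
  have hU : 0 ≤ ∫ x, ‖fderiv ℝ u x‖ ^ 2 := integral_nonneg fun x => sq_nonneg _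
  rw [← hI]
  rcases eq_or_ne I 0 with h0 | h0
  · rw [h0]
    simpa using mul_nonneg hA.le hU
  have ha : 0 < |I| := abs_pos.2 h0
  have hφi : Integrable fun x => ‖fderiv ℝ φ x‖ ^ 2 := by
    have hcont : Continuous (fderiv ℝ φ) := hφ.continuous_fderiv (by simp)
    have hcont' : Continuous fun x => ‖fderiv ℝ φ x‖ ^ 2 := by fun_prop
    refine hcont'.integrable_of_hasCompactSupport ?_
    refine (hc.fderiv (𝕜 := ℝ)).mono fun x hx => ?_
    contrapose! hx
    rw [Function.notMem_support] at hx ⊢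
    rw [hx, norm_zero, zero_pow two_ne_zero]
  have key : |I| ≤ ∫ x, (A / |I| / 2 * ‖fderiv ℝ u x‖ ^ 2 +
      |I| / A / 2 * ‖fderiv ℝ φ x‖ ^ 2) := by
    have hneg := hI.trans (integral_lap_mul_eq_neg hu hφ hc)
    conv_lhs => rw [hneg, abs_neg, ← Real.norm_eq_abs]
    refine norm_integral_le_of_norm_le ((hE.const_mul _).add (hφi.const_mul _))
      (Filter.Eventually.of_forall fun x => ?_)
    refine (abs_sum_apply_single_mul_le _ _).trans ?_
    set p := ‖fderiv ℝ u x‖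
    set q := ‖fderiv ℝ φ x‖
    have : A / |I| / 2 * p ^ 2 + |I| / A / 2 * q ^ 2 - p * q =
        (A * p - |I| * q) ^ 2 / (2 * A * |I|) := by
      field_simp
      ring
    have h' : 0 ≤ (A * p - |I| * q) ^ 2 / (2 * A * |I|) := by positivity
    linarith
  rw [integral_add (hE.const_mul _) (hφi.const_mul _), integral_const_mul,
    integral_const_mul] at key
  have h1 : |I| / A / 2 * ∫ x, ‖fderiv ℝ φ x‖ ^ 2 ≤ |I| / A / 2 * A := by gcongr
  have h2 : |I| / A / 2 * A = |I| / 2 := by field_simp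
  have h3 : |I| / 2 ≤ A / |I| / 2 * ∫ x, ‖fderiv ℝ u x‖ ^ 2 := by linarith
  have h4 := mul_le_mul_of_nonneg_left h3 (by positivity : 0 ≤ 2 * |I|)
  rw [← sq_abs]
  calc |I| ^ 2 = 2 * |I| * (|I| / 2) := by ring
    _ ≤ _ := h4
    _ = _ := by field_simp

theorem stmt_2 :
    ∃ C > (0:ℝ), ∃ C' > (0:ℝ),
      ∀ (z₁ z₂ : EuclideanSpace ℝ (Fin 2)) (m : ℝ)
        (f u : EuclideanSpace ℝ (Fin 2) → ℝ),
        ContDiff ℝ (⊤ : ℕ∞) f → HasCompactSupport f →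
        tsupport f ⊆ ball z₁ 1 ∪ ball z₂ 1 →
        (∫ x, f x) = 0 →
        (∫ x in ball z₁ 1, f x) = m → m ≠ 0 →
        4 ≤ dist z₁ z₂ →
        ContDiff ℝ 2 u →
        (∀ x, lap u x = f x) →
        Integrable (fun x => ‖fderiv ℝ u x‖ ^ 2) →
        C * m ^ 2 * Real.log (dist z₁ z₂) - C' ≤ ∫ x, ‖fderiv ℝ u x‖ ^ 2 := by
  obtain ⟨K, hK0, hK⟩ := exists_norm_deriv_smoothTransition_le
  set V := volume.real (ball (0 : EuclideanSpace ℝ (Fin 2)) 1) with hV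
  have hV0 : 0 < V := ENNReal.toReal_pos (measure_ball_pos _ _ one_pos).ne'
    measure_ball_lt_top.ne
  refine ⟨1 / (4 * V * K ^ 2), by positivity, 1, one_pos, ?_⟩
  intro z₁ z₂ m f u _ _ hsupp _ hm _ hd hu hlap hE
  set d := dist z₁ z₂
  have hR : 1 < d - 1 := by linarith
  have hL := Real.log_pos hR
  set φ := logCutoff z₁ (d - 1) with hφdef
  have hφ : ∀ x, lap u x * φ x = (ball z₁ 1).indicator f x := by
    intro x
    rw [hlap]
    by_cases h1 : x ∈ ball z₁ 1
    · rw [Set.indicator_of_mem h1, hφdef, logCutoff_eq_one hR, mul_one]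
      rw [mem_ball, dist_eq_norm] at h1
      exact h1.le
    · rw [Set.indicator_of_notMem h1]
      by_cases h2 : x ∈ ball z₂ 1
      · rw [hφdef, logCutoff_eq_zero hR, mul_zero]
        rw [mem_ball] at h2
        have := dist_triangle_left z₁ z₂ x
        rw [← dist_eq_norm]
        linarith
      · rw [image_eq_zero_of_notMem_tsupport fun h => (hsupp h).elim h1 h2, zero_mul]
  have hI : ∫ x, lap u x * φ x = m := by
    simp_rw [hφ]
    rw [integral_indicator measurableSet_ball, hm]
  obtain ⟨hint, hval⟩ :=
    integrable_indicator_annulus_norm_sq_inv ((K / Real.log (d - 1)) ^ 2) hR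
  have hA : ∫ x, ‖fderiv ℝ φ x‖ ^ 2 ≤ 2 * V * (K ^ 2 / Real.log (d - 1)) := by
    calc _ ≤ ∫ x, (Set.Icc 1 (d - 1)).indicator
            (fun r => (K / Real.log (d - 1)) ^ 2 * (r ^ 2)⁻¹) ‖x - z₁‖ :=
          integral_mono_of_nonneg (Filter.Eventually.of_forall fun x => by positivity)
            (hint.comp_sub_right z₁)
            (Filter.Eventually.of_forall (norm_fderiv_logCutoff_sq_le hK hR))
      _ = _ := by
          rw [integral_sub_right_eq_self (fun x => (Set.Icc 1 (d - 1)).indicator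
            (fun r => (K / Real.log (d - 1)) ^ 2 * (r ^ 2)⁻¹) ‖x‖) z₁, hval, ← hV]
          field_simp
  have hcap := sq_integral_lap_mul_le hu (contDiff_logCutoff hR)
    (hasCompactSupport_logCutoff hR) hE (by positivity) hA
  rw [hI] at hcap
  have hlog : Real.log d ≤ 2 * Real.log (d - 1) := by
    rw [show 2 * Real.log (d - 1) = Real.log ((d - 1) ^ 2) by rw [Real.log_pow]; norm_num]
    exact Real.log_le_log (by linarith) (by nlinarith)
  suffices h : 1 / (4 * V * K ^ 2) * m ^ 2 * Real.log d ≤ ∫ x, ‖fderiv ℝ u x‖ ^ 2 by linarith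
  calc 1 / (4 * V * K ^ 2) * m ^ 2 * Real.log d
      ≤ 1 / (4 * V * K ^ 2) * (2 * V * (K ^ 2 / Real.log (d - 1)) *
          ∫ x, ‖fderiv ℝ u x‖ ^ 2) * (2 * Real.log (d - 1)) := by
        gcongr
        exact Real.log_nonneg (by linarith)
    _ = _ := by
        field_simp
        norm_num

end
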